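/- Let β, n, β', n' ∈ ℤ and let a, b, c, d ∈ ℤ with ad − bc = 1. Suppose that the substitution (x,y) ↦ (dx + by, cx + ay) transforms the binary cubic x³ − 3βxy² − ny³ into x³ − 3β'xy² − n'y³, i.e. (dx + by)³ − 3β(dx + by)(cx + ay)² − n(cx + ay)³ = x³ − 3β'xy² − n'y³ holds identically in x, y. Then d³ − 3βc²d − nc³ = 1, and (β', n') = (d²β + ncd + β²c², 6β²d²c + 6c²dβn + n + 2c³n² − 2c³β³). -/

import Mathlib

/-- Lemma 5.8 (lem:gcd): if the substitution `(x,y) ↦ (dx+by, cx+ay)` of a matrix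
`g = (a b; c d) ∈ SL₂(ℤ)` transforms the binary cubic `x³ − 3βxy² − ny³` into
`x³ − 3β'xy² − n'y³`, then `d³ − 3βc²d − nc³ = 1` and `(β', n')` is given by the stated
formulas. -/
theorem stmt0 (β n β' n' a b c d : ℤ) (hdet : a * d - b * c = 1)
    (hsub : ∀ x y : ℤ,
      (d * x + b * y) ^ 3 - 3 * β * (d * x + b * y) * (c * x + a * y) ^ 2
          - n * (c * x + a * y) ^ 3
        = x ^ 3 - 3 * β' * x * y ^ 2 - n' * y ^ 3) :
    d ^ 3 - 3 * β * c ^ 2 * d - n * c ^ 3 = 1 ∧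
    β' = d ^ 2 * β + n * c * d + β ^ 2 * c ^ 2 ∧
    n' = 6 * β ^ 2 * d ^ 2 * c + 6 * c ^ 2 * d * β * n + n + 2 * c ^ 3 * n ^ 2
        - 2 * c ^ 3 * β ^ 3 := by
  have h1 := hsub 1 0
  have h2 := hsub 0 1
  have h3 := hsub 1 1
  have h4 := hsub 1 (-1)
  have e0 : d ^ 3 - 3 * β * c ^ 2 * d - n * c ^ 3 = 1 := by linear_combination h1
  have e1 : b * (d ^ 2 - β * c ^ 2) = a * (2 * β * c * d + n * c ^ 2) := by
    linarith [h1, h2, h3, h4]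
  have e2 : β' = -(b ^ 2 * d - β * (2 * a * b * c + d * a ^ 2) - n * c * a ^ 2) := by
    linarith [h1, h2, h3, h4]
  have e3 : n' = -(b ^ 3 - 3 * β * b * a ^ 2 - n * a ^ 3) := by linarith
  have ha : a = d ^ 2 - β * c ^ 2 := by
    linear_combination (-a) * e0 + c * e1 + (d ^ 2 - β * c ^ 2) * hdet
  have hb : b = 2 * β * c * d + n * c ^ 2 := by
    linear_combination (-b) * e0 + (2 * β * c * d + n * c ^ 2) * hdet + d * e1
  refine ⟨e0, ?_, ?_⟩
  · rw [e2, ha, hb]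
    linear_combination (d ^ 2 * β + n * c * d + β ^ 2 * c ^ 2) * e0
  · rw [e3, ha, hb]
    linear_combination (6 * β ^ 2 * d ^ 2 * c + 6 * c ^ 2 * d * β * n + 2 * c ^ 3 * n ^ 2
        - 2 * c ^ 3 * β ^ 3 + n * (d ^ 3 - 3 * β * c ^ 2 * d - n * c ^ 3 + 1)) * e0
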